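/- Let f : ℝ^p × ℝ^q → ℝ be continuously differentiable, α-marginally strongly convex and β-marginally strongly smooth in both its variables, and satisfy C-robust bistability. Let (x*, y*) be a global minimizer of f with minimum value f* and ∇f(x*, y*) = 0, and set κ = β/α. Suppose (x^t, y^t) satisfies y^t ∈ mOPT_f(x^t), and the next alternating-minimization iterates satisfy x^{t+1} ∈ mOPT_f(y^t) and y^{t+1} ∈ mOPT_f(x^{t+1}). Then f(x^{t+1}, y^{t+1}) − f* ≤ η₀·(f(x^t, y^t) − f*), where η₀ = 2κ(1 + Cκ)/(1 + 2κ(1 + Cκ)) < 1. -/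

import Mathlib

open scoped RealInnerProductSpace

/-- The gradient of a function vanishes at a global minimizer. -/
theorem HasGradientAt.eq_zero_of_forall_le {E : Type*} [NormedAddCommGroup E]
    [InnerProductSpace ℝ E] [CompleteSpace E] {g : E → ℝ} {g' x : E}
    (hg : HasGradientAt g g' x) (hmin : ∀ y, g x ≤ g y) : g' = 0 := by
  have h : IsLocalMin g x := Filter.Eventually.of_forall hmin
  simpa using h.hasFDerivAt_eq_zero hg.hasFDerivAt

/-- Per-iteration linear convergence of alternating minimization under `α`-MSC/`β`-MSS and
`C`-robust bistability: if `yᵗ ∈ mOPT_f(xᵗ)`, `x^{t+1} ∈ mOPT_f(yᵗ)` and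
`y^{t+1} ∈ mOPT_f(x^{t+1})`, then with `κ = β/α` the suboptimality contracts by
`η₀ = 2κ(1+Cκ)/(1+2κ(1+Cκ)) < 1`. -/
theorem gam_linear_convergence_step
    {p q : ℕ}
    (f : EuclideanSpace ℝ (Fin p) → EuclideanSpace ℝ (Fin q) → ℝ)
    (gx : EuclideanSpace ℝ (Fin p) → EuclideanSpace ℝ (Fin q) → EuclideanSpace ℝ (Fin p))
    (gy : EuclideanSpace ℝ (Fin p) → EuclideanSpace ℝ (Fin q) → EuclideanSpace ℝ (Fin q))
    (hgx : ∀ x y, HasGradientAt (fun x' => f x' y) (gx x y) x)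
    (hgy : ∀ x y, HasGradientAt (fun y' => f x y') (gy x y) y)
    (α β C : ℝ) (hα : 0 < α) (hβ : 0 < β) (hC : 0 < C)
    (hmscx : ∀ y x1 x2,
      (α/2) * ‖x2 - x1‖^2 ≤ f x2 y - f x1 y - ⟪gx x1 y, x2 - x1⟫ ∧
      f x2 y - f x1 y - ⟪gx x1 y, x2 - x1⟫ ≤ (β/2) * ‖x2 - x1‖^2)
    (hmscy : ∀ x y1 y2,
      (α/2) * ‖y2 - y1‖^2 ≤ f x y2 - f x y1 - ⟪gy x y1, y2 - y1⟫ ∧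
      f x y2 - f x y1 - ⟪gy x y1, y2 - y1⟫ ≤ (β/2) * ‖y2 - y1‖^2)
    (fstar : ℝ) (xs : EuclideanSpace ℝ (Fin p)) (ys : EuclideanSpace ℝ (Fin q))
    (hfs : f xs ys = fstar) (hmin : ∀ x y, fstar ≤ f x y)
    (hgxs : gx xs ys = 0) (hgys : gy xs ys = 0)
    (hrb : ∀ x y xtil ytil,
      (∀ y', f x ytil ≤ f x y') → (∀ x', f xtil y ≤ f x' y) →
      f x ys + f xs y - 2 * fstar ≤ C * (2 * f x y - f x ytil - f xtil y))
    (xt xt1 : EuclideanSpace ℝ (Fin p)) (yt yt1 : EuclideanSpace ℝ (Fin q))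
    (hyt : ∀ y', f xt yt ≤ f xt y')
    (hxt1 : ∀ x', f xt1 yt ≤ f x' yt)
    (hyt1 : ∀ y', f xt1 yt1 ≤ f xt1 y') :
    f xt1 yt1 - fstar
      ≤ (2 * (β/α) * (1 + C * (β/α)) / (1 + 2 * (β/α) * (1 + C * (β/α))))
        * (f xt yt - fstar) ∧
    2 * (β/α) * (1 + C * (β/α)) / (1 + 2 * (β/α) * (1 + C * (β/α))) < 1 := by
  have hκ : 0 < β / α := div_pos hβ hα
  have hK : 0 < 2 * (β/α) * (1 + C * (β/α)) := by positivity
  refine ⟨?_, by rw [div_lt_one (by linarith)]; linarith⟩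
  have hE : 0 ≤ f xt yt - fstar := sub_nonneg.2 (hmin xt yt)
  by_cases hαβ : α ≤ β
  · have hκ1 : 1 ≤ β / α := (one_le_div hα).2 hαβ
    have hg : gx xt1 yt = 0 :=
      (hgx xt1 yt).eq_zero_of_forall_le hxt1
    have h1 := (hmscx yt xt1 xt).1
    rw [hg, inner_zero_left, sub_zero] at h1
    have h2 := (hmscx ys xs xt).1
    have h3 := (hmscx ys xs xt1).2
    rw [hgxs, inner_zero_left, sub_zero, hfs] at h2 h3
    have h4 := hrb xt yt xt1 yt hyt hxt1
    have h5 : ‖xt1 - xs‖ ^ 2 ≤ 2 * ‖xt - xt1‖ ^ 2 + 2 * ‖xt - xs‖ ^ 2 := by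
      have h := norm_sub_le (xt - xs) (xt - xt1)
      rw [sub_sub_sub_cancel_left] at h
      nlinarith [norm_nonneg (xt1 - xs), sq_nonneg (‖xt - xs‖ - ‖xt - xt1‖)]
    have h6 := hyt1 ys
    have h7 := hyt1 yt
    have h8 := hmin xs yt
    have hβκ : β = (β / α) * α := (div_mul_cancel₀ β hα.ne').symm
    set κ := β / α
    have hΔ : 0 ≤ f xt yt - f xt1 yt := sub_nonneg.2 (hxt1 xt)
    have h9 : α / 2 * ‖xt1 - xs‖ ^ 2 ≤ 2 * (1 + C) * (f xt yt - f xt1 yt) := by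
      nlinarith
    have h10 : f xt1 yt1 - fstar ≤ κ * (2 * (1 + C) * (f xt yt - f xt1 yt)) := by
      calc f xt1 yt1 - fstar ≤ β / 2 * ‖xt1 - xs‖ ^ 2 := by linarith
        _ = κ * (α / 2 * ‖xt1 - xs‖ ^ 2) := by rw [hβκ]; ring
        _ ≤ _ := by gcongr
    have h11 : κ * (2 * (1 + C) * (f xt yt - f xt1 yt)) ≤
        2 * κ * (1 + C * κ) * (f xt yt - f xt1 yt1) := by
      calc κ * (2 * (1 + C) * (f xt yt - f xt1 yt))
          = 2 * κ * (1 + C * 1) * (f xt yt - f xt1 yt) := by ring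
        _ ≤ _ := by gcongr
    rw [div_mul_eq_mul_div, le_div_iff₀ (by linarith)]
    linarith
  · have hx : xt1 = xs := by
      have h := (hmscx ys xs xt1).1.trans (hmscx ys xs xt1).2
      have h0 : ‖xt1 - xs‖ ^ 2 = 0 := by nlinarith [sq_nonneg ‖xt1 - xs‖]
      exact sub_eq_zero.1 (norm_eq_zero.1 (pow_eq_zero_iff two_ne_zero |>.1 h0))
    have h := hyt1 ys
    rw [hx, hfs] at h
    rw [hx]
    exact (sub_nonpos.2 h).trans (by positivity)
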